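/- arXiv:1910.03909 — 6 statements merged into one kernel-verified Lean document; each statement's English description precedes it below -/
import Mathlib

section
/- A pair (s, t) of nonzero elements of a unique factorization domain R admits a Tan decomposition if and only if (s, t) is minimal, i.e., there is no prime element p of R with p² ∣ s and p³ ∣ t. -/
/-- Two elements of a commutative monoid with zero have no common prime factor. -/
def NoCommonPrimeFactor {R : Type*} [CommMonoidWithZero R] (x y : R) : Prop :=
  ¬ ∃ p : R, Prime p ∧ p ∣ x ∧ p ∣ y

/-- `(a₀, a₁, a₂, b₀, b₁)` is a Tan decomposition of the pair `(s, t)`: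
`s = a₁·a₂²·b₁·a₀`, `t = a₁·a₂²·b₁²·b₀`, the elements `a₁, a₂, b₁` are squarefree,
`a₁` and `a₂` have no common prime factor, and each `aᵢ` shares no prime factor
with each `bⱼ`.  This is the decomposition underlying S.-L. Tan's triple cover data. -/
def IsTanDecomposition {R : Type*} [CommMonoidWithZero R]
    (s t a₀ a₁ a₂ b₀ b₁ : R) : Prop :=
  s = a₁ * a₂ ^ 2 * b₁ * a₀ ∧
  t = a₁ * a₂ ^ 2 * b₁ ^ 2 * b₀ ∧
  Squarefree a₁ ∧ Squarefree a₂ ∧ Squarefree b₁ ∧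
  NoCommonPrimeFactor a₁ a₂ ∧
  NoCommonPrimeFactor a₀ b₀ ∧ NoCommonPrimeFactor a₀ b₁ ∧
  NoCommonPrimeFactor a₁ b₀ ∧ NoCommonPrimeFactor a₁ b₁ ∧
  NoCommonPrimeFactor a₂ b₀ ∧ NoCommonPrimeFactor a₂ b₁

theorem NoCommonPrimeFactor.pow_mul {R : Type*} [CommRing R] [IsDomain R] {p x y : R}
    (hp : Prime p) (h : NoCommonPrimeFactor x y) (hx : ¬ p ∣ x) (hy : ¬ p ∣ y) {e f : ℕ}
    (hef : e = 0 ∨ f = 0) : NoCommonPrimeFactor (p ^ e * x) (p ^ f * y) := by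
  rintro ⟨q, hq, h1, h2⟩
  have key : ∀ {g : ℕ}, q ∣ p ^ g → g ≠ 0 ∧ p ∣ q := by
    intro g hg
    refine ⟨?_, ?_⟩
    · rintro rfl
      rw [pow_zero] at hg
      exact hq.not_isUnit (isUnit_of_dvd_one hg)
    · exact (hq.associated_of_dvd hp (hq.dvd_of_dvd_pow hg)).symm.dvd
  rcases hq.dvd_or_dvd h1 with h1 | h1 <;> rcases hq.dvd_or_dvd h2 with h2 | h2
  · have := (key h1).1
    have := (key h2).1
    tauto
  · exact hy ((key h1).2.trans h2)
  · exact hx ((key h2).2.trans h1)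
  · exact h ⟨q, hq, h1, h2⟩

theorem squarefree_pow_mul_of_prime {R : Type*} [CommRing R] [IsDomain R]
    [UniqueFactorizationMonoid R] {p x : R}
    (hp : Prime p) (h : Squarefree x) (hx : ¬ p ∣ x) {e : ℕ}
    (he : e ≤ 1) : Squarefree (p ^ e * x) := by
  interval_cases e
  · simpa using h
  · rw [pow_one]
    exact squarefree_mul_iff.2 ⟨hp.irreducible.isRelPrime_iff_not_dvd.2 hx,
      hp.irreducible.squarefree, h⟩

theorem IsTanDecomposition.pow_mul {R : Type*} [CommRing R] [IsDomain R]
    [UniqueFactorizationMonoid R] {p s t a₀ a₁ a₂ b₀ b₁ : R} (hp : Prime p)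
    (hs : ¬ p ∣ s) (ht : ¬ p ∣ t) (h : IsTanDecomposition s t a₀ a₁ a₂ b₀ b₁)
    (e₀ e₁ e₂ f₀ f₁ : ℕ) (h1 : e₁ ≤ 1) (h2 : e₂ ≤ 1) (h3 : f₁ ≤ 1) (h4 : e₁ = 0 ∨ e₂ = 0)
    (h5 : (e₀ = 0 ∧ e₁ = 0 ∧ e₂ = 0) ∨ (f₀ = 0 ∧ f₁ = 0)) :
    IsTanDecomposition (p ^ (e₁ + 2 * e₂ + f₁ + e₀) * s) (p ^ (e₁ + 2 * e₂ + 2 * f₁ + f₀) * t)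
      (p ^ e₀ * a₀) (p ^ e₁ * a₁) (p ^ e₂ * a₂) (p ^ f₀ * b₀) (p ^ f₁ * b₁) := by
  obtain ⟨es, et, q1, q2, q3, n1, n2, n3, n4, n5, n6, n7⟩ := h
  have d0 : ¬ p ∣ a₀ := fun h => hs (es ▸ h.mul_left _)
  have d1 : ¬ p ∣ a₁ := fun h => hs (es ▸ ((h.mul_right _).mul_right _).mul_right _)
  have d2 : ¬ p ∣ a₂ := fun h => hs (es ▸
    (((h.trans (dvd_pow_self _ two_ne_zero)).mul_left _).mul_right _).mul_right _)
  have d3 : ¬ p ∣ b₁ := fun h => hs (es ▸ (h.mul_left _).mul_right _)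
  have d4 : ¬ p ∣ b₀ := fun h => ht (et ▸ h.mul_left _)
  refine ⟨?_, ?_, squarefree_pow_mul_of_prime hp q1 d1 h1, squarefree_pow_mul_of_prime hp q2 d2 h2,
    squarefree_pow_mul_of_prime hp q3 d3 h3, n1.pow_mul hp d1 d2 h4,
    n2.pow_mul hp d0 d4 (by tauto), n3.pow_mul hp d0 d3 (by tauto), n4.pow_mul hp d1 d4 (by tauto),
    n5.pow_mul hp d1 d3 (by tauto), n6.pow_mul hp d2 d4 (by tauto), n7.pow_mul hp d2 d3 (by tauto)⟩
  · rw [es]; ring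
  · rw [et]; ring

theorem exists_tan_aux {R : Type*} [CommRing R] [IsDomain R] [UniqueFactorizationMonoid R]
    (s : R) : ∀ t : R, s ≠ 0 → t ≠ 0 → (¬ ∃ p : R, Prime p ∧ p ^ 2 ∣ s ∧ p ^ 3 ∣ t) →
    ∃ a₀ a₁ a₂ b₀ b₁ : R, IsTanDecomposition s t a₀ a₁ a₂ b₀ b₁ := by
  induction s using (wellFounded_dvdNotUnit (α := R)).induction with
  | _ s ih =>
  intro t hs ht hmin
  by_cases hu : IsUnit s
  · have hn : ∀ u y : R, IsUnit u → NoCommonPrimeFactor u y := by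
      rintro u y hu ⟨p, hp, h, -⟩
      exact hp.not_isUnit (isUnit_of_dvd_unit h hu)
    have h1 := isUnit_one (M := R)
    exact ⟨s, 1, 1, t, 1, by simp, by simp, squarefree_one, squarefree_one, squarefree_one,
      hn _ _ h1, hn _ _ hu, hn _ _ hu, hn _ _ h1, hn _ _ h1, hn _ _ h1, hn _ _ h1⟩
  obtain ⟨p, hpi, hps⟩ := WfDvdMonoid.exists_irreducible_factor hu hs
  have hp := hpi.prime
  obtain ⟨m, x, hx, rfl⟩ := WfDvdMonoid.max_power_factor hs hpi
  obtain ⟨n, y, hy, rfl⟩ := WfDvdMonoid.max_power_factor ht hpi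
  have hm : m ≠ 0 := by
    rintro rfl
    exact hx (by simpa using hps)
  have hx0 : x ≠ 0 := right_ne_zero_of_mul hs
  have hy0 : y ≠ 0 := right_ne_zero_of_mul ht
  obtain ⟨a₀, a₁, a₂, b₀, b₁, h⟩ := ih x
    ⟨hx0, p ^ m, fun h => hp.not_isUnit ((isUnit_pow_iff hm).1 h), mul_comm _ _⟩ y hx0 hy0 (by
      rintro ⟨q, hq, h1, h2⟩
      exact hmin ⟨q, hq, h1.mul_left _, h2.mul_left _⟩)
  have hmn : ¬ (2 ≤ m ∧ 3 ≤ n) := fun ⟨h1, h2⟩ =>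
    hmin ⟨p, hp, (pow_dvd_pow p h1).mul_right _, (pow_dvd_pow p h2).mul_right _⟩
  suffices H : ∃ e₀ e₁ e₂ f₀ f₁ : ℕ, e₁ ≤ 1 ∧ e₂ ≤ 1 ∧ f₁ ≤ 1 ∧ (e₁ = 0 ∨ e₂ = 0) ∧
      ((e₀ = 0 ∧ e₁ = 0 ∧ e₂ = 0) ∨ (f₀ = 0 ∧ f₁ = 0)) ∧
      m = e₁ + 2 * e₂ + f₁ + e₀ ∧ n = e₁ + 2 * e₂ + 2 * f₁ + f₀ by
    obtain ⟨e₀, e₁, e₂, f₀, f₁, h1, h2, h3, h4, h5, rfl, rfl⟩ := H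
    exact ⟨_, _, _, _, _, h.pow_mul hp hx hy e₀ e₁ e₂ f₀ f₁ h1 h2 h3 h4 h5⟩
  by_cases n0 : n = 0
  · exact ⟨m, 0, 0, 0, 0, by omega⟩
  by_cases n1 : n = 1
  · exact ⟨m - 1, 1, 0, 0, 0, by omega⟩
  by_cases m1 : m = 1
  · exact ⟨0, 0, 0, n - 2, 1, by omega⟩
  · exact ⟨m - 2, 0, 1, 0, 0, by omega⟩

theorem IsTanDecomposition.minimal {R : Type*} [CommRing R] [IsDomain R]
    {s t a₀ a₁ a₂ b₀ b₁ : R} (h : IsTanDecomposition s t a₀ a₁ a₂ b₀ b₁) :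
    ¬ ∃ p : R, Prime p ∧ p ^ 2 ∣ s ∧ p ^ 3 ∣ t := by
  rintro ⟨p, hp, hs, ht⟩
  obtain ⟨rfl, rfl, q1, q2, q3, n1, n2, n3, n4, n5, n6, n7⟩ := h
  have sq : ∀ {x : R}, Squarefree x → ¬ p ^ 2 ∣ x := fun hx h =>
    hp.not_isUnit (hx p (by rwa [← sq]))
  have np : ∀ {x : R} {k : ℕ}, ¬ p ∣ x → ¬ p ∣ x ^ k := fun hx h => hx (hp.dvd_of_dvd_pow h)
  by_cases hb : p ∣ b₀ ∨ p ∣ b₁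
  · have d0 : ¬ p ∣ a₀ := fun h => hb.elim (fun h' => n2 ⟨p, hp, h, h'⟩) fun h' => n3 ⟨p, hp, h, h'⟩
    have d1 : ¬ p ∣ a₁ := fun h => hb.elim (fun h' => n4 ⟨p, hp, h, h'⟩) fun h' => n5 ⟨p, hp, h, h'⟩
    have d2 : ¬ p ∣ a₂ := fun h => hb.elim (fun h' => n6 ⟨p, hp, h, h'⟩) fun h' => n7 ⟨p, hp, h, h'⟩
    refine sq q3 (hp.pow_dvd_of_dvd_mul_left 2 (a := a₁ * a₂ ^ 2) (fun h => ?_)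
      (hp.pow_dvd_of_dvd_mul_right 2 d0 hs))
    exact (hp.dvd_or_dvd h).elim d1 (np d2)
  · push Not at hb
    have h3 : p ^ 3 ∣ a₁ * a₂ ^ 2 :=
      hp.pow_dvd_of_dvd_mul_right 3 (np hb.2) (hp.pow_dvd_of_dvd_mul_right 3 hb.1 ht)
    by_cases h1 : p ∣ a₁
    · have d2 : ¬ p ∣ a₂ := fun h => n1 ⟨p, hp, h1, h⟩
      exact sq q1 ((pow_dvd_pow p (by norm_num)).trans (hp.pow_dvd_of_dvd_mul_right 3 (np d2) h3))
    · have h4 : p ^ 3 ∣ a₂ ^ 2 := hp.pow_dvd_of_dvd_mul_left 3 h1 h3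
      obtain ⟨c, rfl⟩ := hp.dvd_of_dvd_pow ((dvd_pow_self p three_ne_zero).trans h4)
      rw [mul_pow, pow_succ p 2, mul_dvd_mul_iff_left (pow_ne_zero 2 hp.ne_zero)] at h4
      have h5 := hp.dvd_of_dvd_pow h4
      exact sq q2 (by rw [_root_.sq]; exact mul_dvd_mul_left p h5)

/-- A pair `(s, t)` of nonzero elements of a UFD admits a Tan decomposition if and
only if `(s, t)` is minimal, i.e. there is no prime `p` with `p² ∣ s` and `p³ ∣ t`. -/
theorem exists_tanDecomposition_iff_minimal
    {R : Type*} [CommRing R] [IsDomain R] [UniqueFactorizationMonoid R]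
    {s t : R} (hs : s ≠ 0) (ht : t ≠ 0) :
    (∃ a₀ a₁ a₂ b₀ b₁ : R, IsTanDecomposition s t a₀ a₁ a₂ b₀ b₁) ↔
      ¬ ∃ p : R, Prime p ∧ p ^ 2 ∣ s ∧ p ^ 3 ∣ t := by
  constructor
  · rintro ⟨a₀, a₁, a₂, b₀, b₁, h⟩
    exact h.minimal
  · exact exists_tan_aux s t hs ht
end

section
/- A Tan decomposition of a pair (s, t) of nonzero elements of a unique factorization domain is unique up to units: if (a₀, a₁, a₂, b₀, b₁) and (a₀′, a₁′, a₂′, b₀′, b₁′) are both Tan decompositions of (s, t), then aᵢ is associated to aᵢ′ for each i ∈ {0,1,2} and bⱼ is associated to bⱼ′ for each j ∈ {0,1}. -/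
theorem tan_assoc_aux {R : Type*} [CommRing R] [IsDomain R] [UniqueFactorizationMonoid R]
    {a b : R} (ha : a ≠ 0) (hb : b ≠ 0)
    (h : ∀ p : R, Prime p → multiplicity p a = multiplicity p b) : Associated a b := by
  have key : ∀ p : R, Prime p → emultiplicity p a = emultiplicity p b := fun p hp => by
    rw [(FiniteMultiplicity.of_prime_left hp ha).emultiplicity_eq_multiplicity,
      (FiniteMultiplicity.of_prime_left hp hb).emultiplicity_eq_multiplicity, h p hp]
  apply associated_of_dvd_dvd
  · exact (UniqueFactorizationMonoid.dvd_iff_emultiplicity_le ha).2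
      fun p hp => (key p hp).le
  · exact (UniqueFactorizationMonoid.dvd_iff_emultiplicity_le hb).2
      fun p hp => (key p hp).ge

theorem tan_ncpf_aux {R : Type*} [CommRing R] {a b p : R} (hp : Prime p)
    (h : NoCommonPrimeFactor a b) : multiplicity p a = 0 ∨ multiplicity p b = 0 := by
  rw [multiplicity_eq_zero, multiplicity_eq_zero]
  by_contra hc
  push Not at hc
  exact h ⟨p, hp, hc.1, hc.2⟩

theorem tan_sqf_aux {R : Type*} [CommRing R] {a p : R} (hp : Prime p)
    (h : Squarefree a) : multiplicity p a ≤ 1 := by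
  by_contra hc
  have h2 : p ^ 2 ∣ a := pow_dvd_of_le_multiplicity (by omega)
  rw [pow_two] at h2
  exact hp.not_isUnit (h p h2)

theorem tan_mul_aux {R : Type*} [CommRing R] [IsDomain R] [UniqueFactorizationMonoid R]
    {a b p : R} (hp : Prime p) (ha : a ≠ 0) (hb : b ≠ 0) :
    multiplicity p (a * b) = multiplicity p a + multiplicity p b :=
  multiplicity_mul hp (FiniteMultiplicity.of_prime_left hp (mul_ne_zero ha hb))

theorem tan_val_aux {R : Type*} [CommRing R] [IsDomain R] [UniqueFactorizationMonoid R]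
    {s t a₀ a₁ a₂ b₀ b₁ p : R} (hp : Prime p) (hs : s ≠ 0) (ht : t ≠ 0)
    (h : IsTanDecomposition s t a₀ a₁ a₂ b₀ b₁) :
    multiplicity p s = multiplicity p a₁ + 2 * multiplicity p a₂ + multiplicity p b₁
      + multiplicity p a₀ ∧
    multiplicity p t = multiplicity p a₁ + 2 * multiplicity p a₂ + 2 * multiplicity p b₁
      + multiplicity p b₀ := by
  obtain ⟨rfl, rfl, -⟩ := h
  simp only [ne_eq, mul_eq_zero, pow_eq_zero_iff two_ne_zero, not_or] at hs ht
  obtain ⟨⟨⟨h1, h2⟩, h3⟩, h0⟩ := hs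
  have h4 := ht.2
  simp only [pow_two]
  constructor
  · rw [tan_mul_aux hp (by simp [*]) h0, tan_mul_aux hp (by simp [*]) h3,
      tan_mul_aux hp h1 (by simp [*]), tan_mul_aux hp h2 h2]
    ring
  · rw [tan_mul_aux hp (by simp [*]) h4, tan_mul_aux hp (by simp [*]) (by simp [*]),
      tan_mul_aux hp h1 (by simp [*]), tan_mul_aux hp h2 h2, tan_mul_aux hp h3 h3]
    ring

theorem tan_ne_aux {R : Type*} [CommRing R] [IsDomain R]
    {s t a₀ a₁ a₂ b₀ b₁ : R} (hs : s ≠ 0) (ht : t ≠ 0)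
    (h : IsTanDecomposition s t a₀ a₁ a₂ b₀ b₁) :
    a₀ ≠ 0 ∧ a₁ ≠ 0 ∧ a₂ ≠ 0 ∧ b₀ ≠ 0 ∧ b₁ ≠ 0 := by
  obtain ⟨rfl, rfl, -⟩ := h
  simp only [ne_eq, mul_eq_zero, pow_eq_zero_iff two_ne_zero, not_or] at hs ht
  tauto

theorem tan_nat_aux {S T x0 x1 x2 y0 y1 : ℕ}
    (e : S = x1 + 2 * x2 + y1 + x0 ∧ T = x1 + 2 * x2 + 2 * y1 + y0)
    (s1 : x1 ≤ 1) (s2 : x2 ≤ 1) (s3 : y1 ≤ 1) (c1 : x1 = 0 ∨ x2 = 0)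
    (c2 : x0 = 0 ∨ y0 = 0) (c3 : x0 = 0 ∨ y1 = 0) (c4 : x1 = 0 ∨ y0 = 0)
    (c5 : x1 = 0 ∨ y1 = 0) (c6 : x2 = 0 ∨ y0 = 0) (c7 : x2 = 0 ∨ y1 = 0) :
    (S < T ∧ S = y1 ∧ T = 2 * y1 + y0 ∧ x0 = 0 ∧ x1 = 0 ∧ x2 = 0) ∨
    (T ≤ S ∧ S = T + x0 ∧ T = x1 + 2 * x2 ∧ x1 ≤ 1 ∧ y0 = 0 ∧ y1 = 0) := by
  rcases Nat.eq_zero_or_pos y1 with h | h <;> rcases Nat.eq_zero_or_pos y0 with h' | h' <;> omega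

/-- A Tan decomposition of a pair `(s, t)` of nonzero elements of a UFD is unique
up to units: any two Tan decompositions have componentwise associated entries. -/
theorem tanDecomposition_unique
    {R : Type*} [CommRing R] [IsDomain R] [UniqueFactorizationMonoid R]
    {s t : R} (hs : s ≠ 0) (ht : t ≠ 0)
    {a₀ a₁ a₂ b₀ b₁ a₀' a₁' a₂' b₀' b₁' : R}
    (h : IsTanDecomposition s t a₀ a₁ a₂ b₀ b₁)
    (h' : IsTanDecomposition s t a₀' a₁' a₂' b₀' b₁') :
    Associated a₀ a₀' ∧ Associated a₁ a₁' ∧ Associated a₂ a₂' ∧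
      Associated b₀ b₀' ∧ Associated b₁ b₁' := by
  obtain ⟨n0, n1, n2, m0, m1⟩ := tan_ne_aux hs ht h
  obtain ⟨n0', n1', n2', m0', m1'⟩ := tan_ne_aux hs ht h'
  have key : ∀ p : R, Prime p → multiplicity p a₀ = multiplicity p a₀' ∧
      multiplicity p a₁ = multiplicity p a₁' ∧ multiplicity p a₂ = multiplicity p a₂' ∧
      multiplicity p b₀ = multiplicity p b₀' ∧ multiplicity p b₁ = multiplicity p b₁' := by
    intro p hp
    have e := tan_val_aux hp hs ht h
    have e' := tan_val_aux hp hs ht h'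
    obtain ⟨-, -, s1, s2, s3, c1, c2, c3, c4, c5, c6, c7⟩ := h
    obtain ⟨-, -, s1', s2', s3', c1', c2', c3', c4', c5', c6', c7'⟩ := h'
    have r := tan_nat_aux e (tan_sqf_aux hp s1) (tan_sqf_aux hp s2) (tan_sqf_aux hp s3)
      (tan_ncpf_aux hp c1) (tan_ncpf_aux hp c2) (tan_ncpf_aux hp c3) (tan_ncpf_aux hp c4) (tan_ncpf_aux hp c5) (tan_ncpf_aux hp c6) (tan_ncpf_aux hp c7)
    have r' := tan_nat_aux e' (tan_sqf_aux hp s1') (tan_sqf_aux hp s2') (tan_sqf_aux hp s3')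
      (tan_ncpf_aux hp c1') (tan_ncpf_aux hp c2') (tan_ncpf_aux hp c3') (tan_ncpf_aux hp c4') (tan_ncpf_aux hp c5') (tan_ncpf_aux hp c6') (tan_ncpf_aux hp c7')
    clear e e'
    omega
  exact ⟨tan_assoc_aux n0 n0' fun p hp => (key p hp).1,
    tan_assoc_aux n1 n1' fun p hp => (key p hp).2.1,
    tan_assoc_aux n2 n2' fun p hp => (key p hp).2.2.1,
    tan_assoc_aux m0 m0' fun p hp => (key p hp).2.2.2.1,
    tan_assoc_aux m1 m1' fun p hp => (key p hp).2.2.2.2⟩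
end

section
/- If (a₀, a₁, a₂, b₀, b₁) is a Tan decomposition of (s, t) in a unique factorization domain R, then gcd(s³, t²) is associated to a₁²·a₂⁴·b₁³; consequently s³ = (a₁²·a₂⁴·b₁³)·(a₁·a₂²·a₀³) and t² = (a₁²·a₂⁴·b₁³)·(b₁·b₀²), so that the abc data of the triple cover satisfy a = 4s³/gcd(s³,t²) = 4a₁a₂²a₀³ and b = 27t²/gcd(s³,t²) = 27b₁b₀² up to units. -/
/-- If `(a₀, a₁, a₂, b₀, b₁)` is a Tan decomposition of `(s, t)` in a UFD, then
`gcd(s³, t²)` is associated to `a₁²·a₂⁴·b₁³`; consequently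
`s³ = (a₁²·a₂⁴·b₁³)·(a₁·a₂²·a₀³)` and `t² = (a₁²·a₂⁴·b₁³)·(b₁·b₀²)`, so that the
abc data of the triple cover satisfy `a = 4s³/gcd(s³,t²) = 4a₁a₂²a₀³` and
`b = 27t²/gcd(s³,t²) = 27b₁b₀²` up to units (expressed via `Associated`). -/
theorem tanDecomposition_gcd_abc
    {R : Type*} [CommRing R] [IsDomain R] [UniqueFactorizationMonoid R] [GCDMonoid R]
    {s t a₀ a₁ a₂ b₀ b₁ : R} (hs : s ≠ 0) (ht : t ≠ 0)
    (h : IsTanDecomposition s t a₀ a₁ a₂ b₀ b₁) :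
    Associated (gcd (s ^ 3) (t ^ 2)) (a₁ ^ 2 * a₂ ^ 4 * b₁ ^ 3) ∧
    s ^ 3 = (a₁ ^ 2 * a₂ ^ 4 * b₁ ^ 3) * (a₁ * a₂ ^ 2 * a₀ ^ 3) ∧
    t ^ 2 = (a₁ ^ 2 * a₂ ^ 4 * b₁ ^ 3) * (b₁ * b₀ ^ 2) ∧
    Associated (4 * s ^ 3) (gcd (s ^ 3) (t ^ 2) * (4 * (a₁ * a₂ ^ 2 * a₀ ^ 3))) ∧
    Associated (27 * t ^ 2) (gcd (s ^ 3) (t ^ 2) * (27 * (b₁ * b₀ ^ 2))) := by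
  obtain ⟨h1, h2, -, -, -, -, h00, h01, h10, h11, h20, h21⟩ := h
  have e1 : s ^ 3 = (a₁ ^ 2 * a₂ ^ 4 * b₁ ^ 3) * (a₁ * a₂ ^ 2 * a₀ ^ 3) := by
    rw [h1]; ring
  have e2 : t ^ 2 = (a₁ ^ 2 * a₂ ^ 4 * b₁ ^ 3) * (b₁ * b₀ ^ 2) := by
    rw [h2]; ring
  have hx : a₁ * a₂ ^ 2 * a₀ ^ 3 ≠ 0 := by
    intro h0
    rw [h0, mul_zero] at e1
    exact pow_ne_zero 3 hs e1
  have hu : IsUnit (gcd (a₁ * a₂ ^ 2 * a₀ ^ 3) (b₁ * b₀ ^ 2)) := by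
    by_contra hn
    have hg : gcd (a₁ * a₂ ^ 2 * a₀ ^ 3) (b₁ * b₀ ^ 2) ≠ 0 := by
      intro h0
      have hd := gcd_dvd_left (a₁ * a₂ ^ 2 * a₀ ^ 3) (b₁ * b₀ ^ 2)
      rw [h0] at hd
      exact hx (zero_dvd_iff.mp hd)
    obtain ⟨p, hp, hpd⟩ := WfDvdMonoid.exists_irreducible_factor hn hg
    have hpp : Prime p := UniqueFactorizationMonoid.irreducible_iff_prime.mp hp
    have hb : p ∣ b₁ ∨ p ∣ b₀ := by
      rcases hpp.dvd_or_dvd (hpd.trans (gcd_dvd_right _ _)) with hb | hb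
      · exact Or.inl hb
      · exact Or.inr (hpp.dvd_of_dvd_pow hb)
    rcases hpp.dvd_or_dvd (hpd.trans (gcd_dvd_left _ _)) with ha | ha
    · rcases hpp.dvd_or_dvd ha with ha | ha
      · rcases hb with hb | hb
        · exact h11 ⟨p, hpp, ha, hb⟩
        · exact h10 ⟨p, hpp, ha, hb⟩
      · have ha := hpp.dvd_of_dvd_pow ha
        rcases hb with hb | hb
        · exact h21 ⟨p, hpp, ha, hb⟩
        · exact h20 ⟨p, hpp, ha, hb⟩
    · have ha := hpp.dvd_of_dvd_pow ha
      rcases hb with hb | hb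
      · exact h01 ⟨p, hpp, ha, hb⟩
      · exact h00 ⟨p, hpp, ha, hb⟩
  have hG : Associated (gcd (s ^ 3) (t ^ 2)) (a₁ ^ 2 * a₂ ^ 4 * b₁ ^ 3) := by
    rw [e1, e2]
    exact (gcd_mul_left' _ _ _).trans (associated_mul_unit_left _ _ hu)
  refine ⟨hG, e1, e2, ?_, ?_⟩
  · have e : 4 * s ^ 3 = (a₁ ^ 2 * a₂ ^ 4 * b₁ ^ 3) * (4 * (a₁ * a₂ ^ 2 * a₀ ^ 3)) := by
      rw [e1]; ring
    rw [e]
    exact hG.symm.mul_right _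
  · have e : 27 * t ^ 2 = (a₁ ^ 2 * a₂ ^ 4 * b₁ ^ 3) * (27 * (b₁ * b₀ ^ 2)) := by
      rw [e2]; ring
    rw [e]
    exact hG.symm.mul_right _
end

section
/- The multiplication on A described by Miranda's rules is well defined, commutative, and associative, with 1 a two-sided identity; hence A is a commutative unital R-algebra that is free of rank 3 as an R-module. -/
/-- Miranda's multiplication on the free module `A = R·1 ⊕ R·z ⊕ R·w`
(an element `x₁·1 + x₂·z + x₃·w` is encoded as the triple `(x₁, x₂, x₃)`),
given by the R-bilinear extension of the rules `1` is the identity,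
`z·z = 2e + a·z + b·w`, `z·w = w·z = −f − d·z − a·w`, `w·w = 2g + c·z + d·w`,
where `e = a² − bd`, `f = ad − bc`, `g = d² − ac`. -/
def mirandaMul {R : Type*} [CommRing R] (a b c d : R) (x y : R × R × R) : R × R × R :=
  (x.1 * y.1 + 2 * (a ^ 2 - b * d) * (x.2.1 * y.2.1)
      - (a * d - b * c) * (x.2.1 * y.2.2 + x.2.2 * y.2.1)
      + 2 * (d ^ 2 - a * c) * (x.2.2 * y.2.2),
   x.1 * y.2.1 + x.2.1 * y.1 + a * (x.2.1 * y.2.1)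
      - d * (x.2.1 * y.2.2 + x.2.2 * y.2.1) + c * (x.2.2 * y.2.2),
   x.1 * y.2.2 + x.2.2 * y.1 + b * (x.2.1 * y.2.1)
      - a * (x.2.1 * y.2.2 + x.2.2 * y.2.1) + d * (x.2.2 * y.2.2))

/-- Miranda's multiplication on `A = R·1 ⊕ R·z ⊕ R·w` is well defined (it is
`R`-bilinear in each argument), commutative and associative, and `1 = (1,0,0)` is a
two-sided identity; hence `A` is a commutative unital `R`-algebra which, as an
`R`-module, is free of rank 3 (being `R × R × R`). -/
theorem mirandaMul_bilinear_comm_assoc_one {R : Type*} [CommRing R] (a b c d : R) :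
    (∀ r : R, ∀ x x' y : R × R × R,
        mirandaMul a b c d (r • x + x') y
          = r • mirandaMul a b c d x y + mirandaMul a b c d x' y) ∧
    (∀ r : R, ∀ x y y' : R × R × R,
        mirandaMul a b c d x (r • y + y')
          = r • mirandaMul a b c d x y + mirandaMul a b c d x y') ∧
    (∀ x y : R × R × R, mirandaMul a b c d x y = mirandaMul a b c d y x) ∧
    (∀ x y z : R × R × R,
        mirandaMul a b c d (mirandaMul a b c d x y) z
          = mirandaMul a b c d x (mirandaMul a b c d y z)) ∧
    (∀ x : R × R × R,
        mirandaMul a b c d (1, 0, 0) x = x ∧ mirandaMul a b c d x (1, 0, 0) = x) := by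
  refine ⟨?_, ?_, ?_, ?_, ?_⟩
  · rintro r ⟨x1, x2, x3⟩ ⟨x1', x2', x3'⟩ ⟨y1, y2, y3⟩
    simp only [mirandaMul, Prod.smul_mk, Prod.mk_add_mk, smul_eq_mul, Prod.mk.injEq]
    refine ⟨?_, ?_, ?_⟩ <;> ring
  · rintro r ⟨x1, x2, x3⟩ ⟨y1, y2, y3⟩ ⟨y1', y2', y3'⟩
    simp only [mirandaMul, Prod.smul_mk, Prod.mk_add_mk, smul_eq_mul, Prod.mk.injEq]
    refine ⟨?_, ?_, ?_⟩ <;> ring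
  · rintro ⟨x1, x2, x3⟩ ⟨y1, y2, y3⟩
    simp only [mirandaMul, Prod.mk.injEq]
    refine ⟨?_, ?_, ?_⟩ <;> ring
  · rintro ⟨x1, x2, x3⟩ ⟨y1, y2, y3⟩ ⟨z1, z2, z3⟩
    simp only [mirandaMul, Prod.mk.injEq]
    refine ⟨?_, ?_, ?_⟩ <;> ring
  · rintro ⟨x1, x2, x3⟩
    simp only [mirandaMul, Prod.mk.injEq]
    refine ⟨⟨?_, ?_, ?_⟩, ⟨?_, ?_, ?_⟩⟩ <;> ring
end

section
/- In Miranda's algebra A, the basis elements satisfy the cubic equations z³ = 3e·z + (2ae − bf) and w³ = 3g·w + (2dg − cf), where e = a² − bd, f = ad − bc, g = d² − ac. -/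
/-- In Miranda's algebra `A`, the basis elements `z = (0,1,0)` and `w = (0,0,1)`
satisfy the cubic equations `z³ = 3e·z + (2ae − bf)` and `w³ = 3g·w + (2dg − cf)`,
where `e = a² − bd`, `f = ad − bc`, `g = d² − ac`. -/
theorem mirandaMul_cube_z_w {R : Type*} [CommRing R] (a b c d : R) :
    mirandaMul a b c d (0, 1, 0) (mirandaMul a b c d (0, 1, 0) (0, 1, 0))
      = (2 * a * (a ^ 2 - b * d) - b * (a * d - b * c), 3 * (a ^ 2 - b * d), 0) ∧
    mirandaMul a b c d (0, 0, 1) (mirandaMul a b c d (0, 0, 1) (0, 0, 1))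
      = (2 * d * (d ^ 2 - a * c) - c * (a * d - b * c), 0, 3 * (d ^ 2 - a * c)) := by
  refine ⟨Prod.ext ?_ (Prod.ext ?_ ?_), Prod.ext ?_ (Prod.ext ?_ ?_)⟩ <;>
    simp only [mirandaMul] <;> ring
end

section
/- If R is a nontrivial commutative ring and b = 0, then in Miranda's algebra A one has (z − 2a)·(z + a) = 0 with both factors nonzero, so A has zero divisors; symmetrically, if c = 0 then (w − 2d)·(w + d) = 0 with both factors nonzero. Consequently, if A is an integral domain then b ≠ 0 and c ≠ 0. -/
/-- If `R` is a nontrivial commutative ring and `b = 0`, then in Miranda's algebra `A`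
one has `(z − 2a)·(z + a) = 0` with both factors nonzero, so `A` has zero divisors;
symmetrically, if `c = 0` then `(w − 2d)·(w + d) = 0` with both factors nonzero.
Consequently, if `A` is an integral domain (has no zero divisors) then `b ≠ 0` and
`c ≠ 0`.  Here `z − 2a = (−2a, 1, 0)`, `z + a = (a, 1, 0)`, `w − 2d = (−2d, 0, 1)`,
`w + d = (d, 0, 1)`. -/
theorem mirandaMul_zero_divisors {R : Type*} [CommRing R] [Nontrivial R]
    (a b c d : R) :
    (b = 0 →
      mirandaMul a b c d (-(2 * a), 1, 0) (a, 1, 0) = 0 ∧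
      ((-(2 * a), 1, 0) : R × R × R) ≠ 0 ∧ ((a, 1, 0) : R × R × R) ≠ 0) ∧
    (c = 0 →
      mirandaMul a b c d (-(2 * d), 0, 1) (d, 0, 1) = 0 ∧
      ((-(2 * d), 0, 1) : R × R × R) ≠ 0 ∧ ((d, 0, 1) : R × R × R) ≠ 0) ∧
    ((∀ x y : R × R × R, mirandaMul a b c d x y = 0 → x = 0 ∨ y = 0) →
      b ≠ 0 ∧ c ≠ 0) := by
  have hz : b = 0 →
      mirandaMul a b c d (-(2 * a), 1, 0) (a, 1, 0) = 0 ∧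
      ((-(2 * a), 1, 0) : R × R × R) ≠ 0 ∧ ((a, 1, 0) : R × R × R) ≠ 0 := by
    intro hb
    subst hb
    refine ⟨?_, by simp [Prod.ext_iff], by simp [Prod.ext_iff]⟩
    refine Prod.ext ?_ (Prod.ext ?_ ?_) <;> simp only [mirandaMul, Prod.fst_zero, Prod.snd_zero] <;> ring
  have hw : c = 0 →
      mirandaMul a b c d (-(2 * d), 0, 1) (d, 0, 1) = 0 ∧
      ((-(2 * d), 0, 1) : R × R × R) ≠ 0 ∧ ((d, 0, 1) : R × R × R) ≠ 0 := by
    intro hc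
    subst hc
    refine ⟨?_, by simp [Prod.ext_iff], by simp [Prod.ext_iff]⟩
    refine Prod.ext ?_ (Prod.ext ?_ ?_) <;> simp only [mirandaMul, Prod.fst_zero, Prod.snd_zero] <;> ring
  refine ⟨hz, hw, fun h => ⟨fun hb => ?_, fun hc => ?_⟩⟩
  · obtain ⟨h0, h1, h2⟩ := hz hb
    exact (h _ _ h0).elim h1 h2
  · obtain ⟨h0, h1, h2⟩ := hw hc
    exact (h _ _ h0).elim h1 h2
end
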